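/- arXiv:2205.03476 — 6 statements merged into one kernel-verified Lean document; each statement's English description precedes it below -/
import Mathlib

section
/- Let X be a nonempty finite type, let P : X → X → ℝ be a row-stochastic matrix, let γ be a real number with 0 ≤ γ < 1, and let ρ₀ : X → ℝ be a probability vector. Define the occupancy measure ρ = ∑_{t=0}^∞ γ^t (ρ₀ ⬝ P^t) and the modified matrix P̃ x x' = (1-γ)·ρ₀ x' + γ·P x x'. Then the probability vector (1-γ)·ρ is a stationary distribution of P̃, i.e. ((1-γ)·ρ) ⬝ P̃ = (1-γ)·ρ. -/
open Matrix

theorem Matrix.vecMul_pow_nonneg {X : Type*} [Fintype X] [DecidableEq X] {P : Matrix X X ℝ}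
    (hP : ∀ x y, 0 ≤ P x y) {v : X → ℝ} (hv : ∀ x, 0 ≤ v x) (t : ℕ) (x : X) :
    0 ≤ (v ᵥ* P ^ t) x := by
  induction t generalizing x with
  | zero => simpa using hv x
  | succ t ih =>
    rw [pow_succ, ← vecMul_vecMul]
    exact Finset.sum_nonneg fun y _ => mul_nonneg (ih y) (hP y x)

theorem Matrix.sum_vecMul_of_row_sum_eq_one {X : Type*} [Fintype X] {P : Matrix X X ℝ}
    (hP : ∀ x, ∑ y, P x y = 1) (v : X → ℝ) : ∑ x, (v ᵥ* P) x = ∑ x, v x := by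
  simp only [vecMul, dotProduct]
  rw [Finset.sum_comm]
  simp [← Finset.mul_sum, hP]

theorem Matrix.sum_vecMul_pow_of_row_sum_eq_one {X : Type*} [Fintype X] [DecidableEq X]
    {P : Matrix X X ℝ} (hP : ∀ x, ∑ y, P x y = 1) (v : X → ℝ) (t : ℕ) :
    ∑ x, (v ᵥ* P ^ t) x = ∑ x, v x := by
  induction t with
  | zero => simp
  | succ t ih => rw [pow_succ, ← vecMul_vecMul, sum_vecMul_of_row_sum_eq_one hP, ih]

theorem Matrix.summable_discounted_vecMul_pow {X : Type*} [Fintype X] [DecidableEq X]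
    {P : Matrix X X ℝ} (hP0 : ∀ x y, 0 ≤ P x y) (hP1 : ∀ x, ∑ y, P x y = 1)
    {γ : ℝ} (hγ0 : 0 ≤ γ) (hγ1 : γ < 1) {v : X → ℝ} (hv : ∀ x, 0 ≤ v x) :
    Summable fun t : ℕ => γ ^ t • (v ᵥ* P ^ t) := by
  refine Pi.summable.2 fun x => ?_
  refine Summable.of_nonneg_of_le
    (fun t => mul_nonneg (pow_nonneg hγ0 t) (vecMul_pow_nonneg hP0 hv t x)) (fun t => ?_)
    ((summable_geometric_of_lt_one hγ0 hγ1).mul_right (∑ y, v y))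
  refine mul_le_mul_of_nonneg_left ?_ (pow_nonneg hγ0 t)
  rw [← sum_vecMul_pow_of_row_sum_eq_one hP1 v t]
  exact Finset.single_le_sum (f := v ᵥ* P ^ t) (fun y _ => vecMul_pow_nonneg hP0 hv t y)
    (Finset.mem_univ x)

/-- The normalized occupancy measure `(1-γ) • ρ` is a stationary
distribution of the modified matrix `P̃ x x' = (1-γ) * ρ₀ x' + γ * P x x'`. -/
theorem stmt_4 {X : Type*} [Fintype X] [Nonempty X] [DecidableEq X]
    (P : Matrix X X ℝ) (hP0 : ∀ x y, 0 ≤ P x y) (hP1 : ∀ x, ∑ y, P x y = 1)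
    (γ : ℝ) (hγ0 : 0 ≤ γ) (hγ1 : γ < 1)
    (ρ₀ : X → ℝ) (hρ₀0 : ∀ x, 0 ≤ ρ₀ x) (hρ₀1 : ∑ x, ρ₀ x = 1)
    (ρ : X → ℝ) (hρ : ρ = ∑' t : ℕ, γ ^ t • (ρ₀ ᵥ* (P ^ t)))
    (Pt : Matrix X X ℝ) (hPt : ∀ x x', Pt x x' = (1 - γ) * ρ₀ x' + γ * P x x') :
    ((1 - γ) • ρ) ᵥ* Pt = (1 - γ) • ρ := by
  have hsum : HasSum (fun t : ℕ => γ ^ t • (ρ₀ ᵥ* (P ^ t))) ρ :=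
    hρ ▸ (summable_discounted_vecMul_pow hP0 hP1 hγ0 hγ1 hρ₀0).hasSum
  have hmass : ∑ x, ρ x = (1 - γ)⁻¹ := by
    refine (hasSum_sum fun x _ => Pi.hasSum.1 hsum x).unique ?_
    simpa [← Finset.mul_sum, sum_vecMul_pow_of_row_sum_eq_one hP1, hρ₀1]
      using hasSum_geometric_of_lt_one hγ0 hγ1
  have hbellman : ρ = ρ₀ + γ • (ρ ᵥ* P) := by
    have hshift : HasSum (fun t : ℕ => γ ^ (t + 1) • (ρ₀ ᵥ* (P ^ (t + 1)))) (γ • (ρ ᵥ* P)) := by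
      have h := (hsum.map P.vecMulLinear
        (continuous_id.matrix_vecMul continuous_const)).const_smul γ
      refine h.congr_fun fun t => ?_
      simp [vecMul_vecMul, pow_succ, smul_smul, mul_comm]
    refine hsum.unique ?_
    simpa only [pow_zero, one_smul, vecMul_one] using
      HasSum.zero_add (f := fun t : ℕ => γ ^ t • (ρ₀ ᵥ* (P ^ t))) hshift
  have hPt' : Pt = vecMulVec 1 ((1 - γ) • ρ₀) + γ • P := by
    ext x y
    simp [hPt]
  have hne : 1 - γ ≠ 0 := by linarith
  have hone : ρ ⬝ᵥ 1 = (1 - γ)⁻¹ := by rw [dotProduct_one, hmass]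
  rw [hPt', smul_vecMul, vecMul_add, vecMul_vecMulVec, hone, vecMul_smul, smul_smul,
    inv_mul_cancel₀ hne, one_smul, ← hbellman]
end

section
/- Let X be a nonempty finite type, let P : X → X → ℝ be a row-stochastic matrix, and let γ be a real number with 0 < γ < 1. Then there exists a unique matrix L : X → X → ℝ satisfying L i i = 0 for all i and L i j = 1 + γ·∑_k L i k · P k j for all i ≠ j; moreover L i j ≥ 1 for all i ≠ j. -/
/-- A nonnegative vector dominated by its discounted image under a row-stochastic matrix
vanishes, since the matrix preserves total mass. -/
theorem eq_zero_of_le_discounted_vecMul {X : Type*} [Fintype X] {P : Matrix X X ℝ}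
    (hP1 : ∀ x, ∑ y, P x y = 1) {γ : ℝ} (hγ1 : γ < 1) {v : X → ℝ} (hv0 : ∀ j, 0 ≤ v j)
    (hv : ∀ j, v j ≤ γ * ∑ k, v k * P k j) (j : X) : v j = 0 := by
  have hmass : ∑ j, ∑ k, v k * P k j = ∑ k, v k := by
    rw [Finset.sum_comm]
    simp [← Finset.mul_sum, hP1]
  have hle : ∑ j, v j ≤ γ * ∑ j, v j :=
    calc ∑ j, v j ≤ ∑ j, γ * ∑ k, v k * P k j := Finset.sum_le_sum fun j _ => hv j
      _ = γ * ∑ j, v j := by rw [← Finset.mul_sum, hmass]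
  have hsum : 0 ≤ ∑ j, v j := Finset.sum_nonneg fun j _ => hv0 j
  have hzero : ∑ j, v j = 0 := by nlinarith
  exact (Finset.sum_eq_zero_iff_of_nonneg fun j _ => hv0 j).1 hzero j (Finset.mem_univ j)

/-- The homogeneous hitting-time equation with target `i` has only the zero solution. -/
theorem eq_zero_of_homogeneous_hitting {X : Type*} [Fintype X] {P : Matrix X X ℝ}
    (hP0 : ∀ x y, 0 ≤ P x y) (hP1 : ∀ x, ∑ y, P x y = 1) {γ : ℝ} (hγ0 : 0 < γ) (hγ1 : γ < 1)
    {i : X} {v : X → ℝ} (hi : v i = 0) (hv : ∀ j, i ≠ j → v j = γ * ∑ k, v k * P k j) :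
    v = 0 := by
  funext j
  refine abs_eq_zero.1 (eq_zero_of_le_discounted_vecMul hP1 hγ1 (fun j => abs_nonneg (v j))
    (fun j => ?_) j)
  by_cases hj : i = j
  · subst hj
    rw [hi, abs_zero]
    exact mul_nonneg hγ0.le (Finset.sum_nonneg fun k _ => mul_nonneg (abs_nonneg _) (hP0 k _))
  · rw [hv j hj, abs_mul, abs_of_pos hγ0]
    refine mul_le_mul_of_nonneg_left ((Finset.abs_sum_le_sum_abs _ _).trans_eq ?_) hγ0.le
    exact Finset.sum_congr rfl fun k _ => by rw [abs_mul, abs_of_nonneg (hP0 k j)]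

/-- The hitting-time equation with target `i` has a solution. -/
theorem exists_hitting_solution {X : Type*} [Fintype X] {P : Matrix X X ℝ}
    (hP0 : ∀ x y, 0 ≤ P x y) (hP1 : ∀ x, ∑ y, P x y = 1) {γ : ℝ} (hγ0 : 0 < γ) (hγ1 : γ < 1)
    (i : X) : ∃ v : X → ℝ, v i = 0 ∧ ∀ j, i ≠ j → v j = 1 + γ * ∑ k, v k * P k j := by
  classical
  let T : (X → ℝ) →ₗ[ℝ] (X → ℝ) :=
    { toFun := fun v j => v j - if i = j then 0 else γ * ∑ k, v k * P k j
      map_add' := fun v w => by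
        funext j
        by_cases hj : i = j
        · simp [hj]
        · simp only [Pi.add_apply, if_neg hj, add_mul, Finset.sum_add_distrib]
          ring
      map_smul' := fun c v => by
        funext j
        by_cases hj : i = j
        · simp [hj]
        · simp only [Pi.smul_apply, smul_eq_mul, if_neg hj, RingHom.id_apply, mul_assoc,
            ← Finset.mul_sum]
          ring }
  have hT : ∀ v j, T v j = v j - if i = j then 0 else γ * ∑ k, v k * P k j := fun _ _ => rfl
  have hinj : Function.Injective T := by
    refine (injective_iff_map_eq_zero T).2 fun v hv => ?_
    refine eq_zero_of_homogeneous_hitting hP0 hP1 hγ0 hγ1 (i := i) ?_ fun j hj => ?_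
    · simpa [hv] using (hT v i).symm
    · have h := hT v j
      rw [hv, if_neg hj, Pi.zero_apply] at h
      linarith
  obtain ⟨v, hv⟩ := LinearMap.injective_iff_surjective.1 hinj fun j => if i = j then 0 else 1
  refine ⟨v, ?_, fun j hj => ?_⟩
  · simpa [hv] using (hT v i).symm
  · have h := hT v j
    simp only [hv, if_neg hj] at h
    linarith

/-- Every solution of the hitting-time equation with target `i` is nonnegative. -/
theorem hitting_solution_nonneg {X : Type*} [Fintype X] {P : Matrix X X ℝ}
    (hP0 : ∀ x y, 0 ≤ P x y) (hP1 : ∀ x, ∑ y, P x y = 1) {γ : ℝ} (hγ0 : 0 < γ) (hγ1 : γ < 1)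
    {i : X} {v : X → ℝ} (hi : v i = 0) (hv : ∀ j, i ≠ j → v j = 1 + γ * ∑ k, v k * P k j)
    (j : X) : 0 ≤ v j := by
  have hneg : max (-v j) 0 = 0 := by
    refine eq_zero_of_le_discounted_vecMul hP1 hγ1 (v := fun j => max (-v j) 0)
      (fun j => le_max_right _ _) (fun j => ?_) j
    have hnonneg : 0 ≤ γ * ∑ k, max (-v k) 0 * P k j :=
      mul_nonneg hγ0.le (Finset.sum_nonneg fun k _ => mul_nonneg (le_max_right _ _) (hP0 k j))
    refine max_le ?_ hnonneg
    by_cases hj : i = j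
    · subst hj
      simpa [hi] using hnonneg
    · have hle : ∑ k, -v k * P k j ≤ ∑ k, max (-v k) 0 * P k j :=
        Finset.sum_le_sum fun k _ => mul_le_mul_of_nonneg_right (le_max_left _ _) (hP0 k j)
      have hmul := mul_le_mul_of_nonneg_left hle hγ0.le
      simp only [neg_mul, Finset.sum_neg_distrib, mul_neg] at hmul
      linarith [hv j hj]
  linarith [max_eq_right_iff.1 hneg]

/-- For a row-stochastic matrix `P` and `0 < γ < 1`, there is a
unique matrix `L` with `L i i = 0` and `L i j = 1 + γ * ∑ₖ L i k * P k j` for `i ≠ j`;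
moreover every such `L` satisfies `L i j ≥ 1` for `i ≠ j`. -/
theorem stmt_8 {X : Type*} [Fintype X] [Nonempty X]
    (P : Matrix X X ℝ) (hP0 : ∀ x y, 0 ≤ P x y) (hP1 : ∀ x, ∑ y, P x y = 1)
    (γ : ℝ) (hγ0 : 0 < γ) (hγ1 : γ < 1) :
    (∃! L : X → X → ℝ, (∀ i, L i i = 0) ∧
      ∀ i j, i ≠ j → L i j = 1 + γ * ∑ k, L i k * P k j) ∧
    (∀ L : X → X → ℝ, (∀ i, L i i = 0) →
      (∀ i j, i ≠ j → L i j = 1 + γ * ∑ k, L i k * P k j) →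
      ∀ i j, i ≠ j → 1 ≤ L i j) := by
  refine ⟨?_, fun L hL0 hL i j hij => ?_⟩
  · choose L hL0 hL using exists_hitting_solution hP0 hP1 hγ0 hγ1
    refine ⟨L, ⟨hL0, hL⟩, fun M ⟨hM0, hM⟩ => funext fun i => sub_eq_zero.1 ?_⟩
    refine eq_zero_of_homogeneous_hitting hP0 hP1 hγ0 hγ1 (i := i) ?_ fun j hj => ?_
    · simp [hL0, hM0]
    · simp only [Pi.sub_apply, sub_mul, Finset.sum_sub_distrib]
      linarith [hL i j hj, hM i j hj]
  · have hsum : 0 ≤ γ * ∑ k, L i k * P k j :=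
      mul_nonneg hγ0.le (Finset.sum_nonneg fun k _ => mul_nonneg
        (hitting_solution_nonneg hP0 hP1 hγ0 hγ1 (hL0 i) (hL i) k) (hP0 k j))
    linarith [hL i j hij]
end

section
/- Let X be a nonempty finite type, let P : X → X → ℝ be a row-stochastic matrix, let γ be a real number with 0 < γ < 1, and let ρ₀ : X → ℝ be a probability vector. Suppose L : X → X → ℝ satisfies L i i = 0 for all i and L i j = 1 + γ·∑_k L i k · P k j for all i ≠ j, and suppose that for every i the quantity (1-γ)·∑_k L i k · ρ₀ k is strictly less than 1. Define T i j = L i j / (1 - (1-γ)·∑_k L i k · ρ₀ k). Then T satisfies T i i = 0 for all i and T i j = 1 + (1-γ)·∑_k T i k · ρ₀ k + γ·∑_k T i k · P k j for all i ≠ j. -/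
/-- If `L` is the `(1-γ)`-discounted hitting time of `P` and the
renormalization denominators are positive, then
`T i j = L i j / (1 - (1-γ) * ∑ₖ L i k * ρ₀ k)` satisfies the recursion of the mean
first-hitting time of the modified chain `P̃ x x' = (1-γ) * ρ₀ x' + γ * P x x'`. -/
theorem stmt_9 {X : Type*} [Fintype X] [Nonempty X]
    (P : Matrix X X ℝ) (hP0 : ∀ x y, 0 ≤ P x y) (hP1 : ∀ x, ∑ y, P x y = 1)
    (γ : ℝ) (hγ0 : 0 < γ) (hγ1 : γ < 1)
    (ρ₀ : X → ℝ) (hρ₀0 : ∀ x, 0 ≤ ρ₀ x) (hρ₀1 : ∑ x, ρ₀ x = 1)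
    (L : X → X → ℝ) (hLdiag : ∀ i, L i i = 0)
    (hLrec : ∀ i j, i ≠ j → L i j = 1 + γ * ∑ k, L i k * P k j)
    (hden : ∀ i, (1 - γ) * ∑ k, L i k * ρ₀ k < 1)
    (T : X → X → ℝ)
    (hT : ∀ i j, T i j = L i j / (1 - (1 - γ) * ∑ k, L i k * ρ₀ k)) :
    (∀ i, T i i = 0) ∧
    (∀ i j, i ≠ j →
      T i j = 1 + (1 - γ) * (∑ k, T i k * ρ₀ k) + γ * ∑ k, T i k * P k j) := by
  refine ⟨fun i => by rw [hT, hLdiag, zero_div], fun i j hij => ?_⟩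
  have hD : 1 - (1 - γ) * ∑ k, L i k * ρ₀ k ≠ 0 := (sub_pos.2 (hden i)).ne'
  have hsum (f : X → ℝ) : ∑ k, T i k * f k =
      (∑ k, L i k * f k) / (1 - (1 - γ) * ∑ k, L i k * ρ₀ k) := by
    rw [Finset.sum_div]
    exact Finset.sum_congr rfl fun k _ => by rw [hT, div_mul_eq_mul_div]
  rw [hsum ρ₀, hsum fun k => P k j, hT, hLrec i j hij]
  field_simp
  ring
end

section
/- Let X be a nonempty finite type and let Q : X → X → ℝ be a row-stochastic matrix with all entries strictly positive. Then there exists a unique matrix T : X → X → ℝ satisfying T i i = 0 for all i and T i j = 1 + ∑_k T i k · Q k j for all i ≠ j, and this T satisfies T i j ≥ 1 for all i ≠ j. -/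
/-- A nonnegative vector vanishing at `i` that is subinvariant away from `i` under a positive
row-stochastic matrix is zero. -/
lemma eq_zero_of_le_sum_mul {X : Type*} [Fintype X]
    {Q : Matrix X X ℝ} (hQ0 : ∀ x y, 0 < Q x y) (hQ1 : ∀ x, ∑ y, Q x y = 1)
    {i : X} {u : X → ℝ} (hu : ∀ j, 0 ≤ u j) (hi : u i = 0)
    (h : ∀ j, i ≠ j → u j ≤ ∑ k, u k * Q k j) (j : X) : u j = 0 := by
  classical
  have hswap : ∑ j, ∑ k, u k * Q k j = ∑ k, u k := by
    rw [Finset.sum_comm]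
    simp [← Finset.mul_sum, hQ1]
  have hle : ∑ j ∈ Finset.univ.erase i, u j ≤
      ∑ j ∈ Finset.univ.erase i, ∑ k, u k * Q k j :=
    Finset.sum_le_sum fun j hj => h j (Finset.ne_of_mem_erase hj).symm
  have h1 := Finset.add_sum_erase Finset.univ u (Finset.mem_univ i)
  have h2 := Finset.add_sum_erase Finset.univ (fun j => ∑ k, u k * Q k j) (Finset.mem_univ i)
  have hterm : ∀ k ∈ Finset.univ, 0 ≤ u k * Q k i :=
    fun k _ => mul_nonneg (hu k) (hQ0 k i).le
  have hzero : ∑ k, u k * Q k i = 0 :=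
    le_antisymm (by linarith) (Finset.sum_nonneg hterm)
  have hj := (Finset.sum_eq_zero_iff_of_nonneg hterm).1 hzero j (Finset.mem_univ j)
  exact (mul_eq_zero.1 hj).resolve_right (ne_of_gt (hQ0 j i))

/-- A vector vanishing at `i` that is invariant away from `i` under a positive row-stochastic
matrix is zero. -/
lemma eq_zero_of_eq_sum_mul {X : Type*} [Fintype X]
    {Q : Matrix X X ℝ} (hQ0 : ∀ x y, 0 < Q x y) (hQ1 : ∀ x, ∑ y, Q x y = 1)
    {i : X} {u : X → ℝ} (hi : u i = 0)
    (h : ∀ j, i ≠ j → u j = ∑ k, u k * Q k j) : u = 0 := by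
  funext j
  refine (abs_eq_zero (a := u j)).1 (eq_zero_of_le_sum_mul (i := i) (u := fun j => |u j|) hQ0 hQ1
    (fun j => abs_nonneg _) (by simp [hi]) (fun j hj => ?_) j)
  calc |u j| = |∑ k, u k * Q k j| := by rw [← h j hj]
    _ ≤ ∑ k, |u k * Q k j| := Finset.abs_sum_le_sum_abs _ _
    _ = ∑ k, |u k| * Q k j := by simp [abs_mul, abs_of_pos (hQ0 _ _)]

/-- The hitting-time equations for a fixed target `i` have a solution. -/
lemma exists_eq_one_add_sum_mul {X : Type*} [Fintype X]
    {Q : Matrix X X ℝ} (hQ0 : ∀ x y, 0 < Q x y) (hQ1 : ∀ x, ∑ y, Q x y = 1) (i : X) :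
    ∃ t : X → ℝ, t i = 0 ∧ ∀ j, i ≠ j → t j = 1 + ∑ k, t k * Q k j := by
  classical
  let L : (X → ℝ) →ₗ[ℝ] (X → ℝ) :=
    { toFun := fun t j => if i = j then t j else t j - ∑ k, t k * Q k j
      map_add' := fun s t => by
        funext j
        by_cases hj : i = j
        · simp [hj]
        · simp only [hj, if_false, Pi.add_apply, add_mul, Finset.sum_add_distrib]
          ring
      map_smul' := fun c t => by
        funext j
        by_cases hj : i = j
        · simp [hj]
        · simp [hj, mul_sub, Finset.mul_sum, mul_assoc] }
  have hL : ∀ t j, L t j = if i = j then t j else t j - ∑ k, t k * Q k j := fun _ _ => rfl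
  have hinj : Function.Injective L := by
    rw [injective_iff_map_eq_zero]
    intro t ht
    refine eq_zero_of_eq_sum_mul hQ0 hQ1 (i := i) ?_ fun j hj => ?_
    · simpa [hL] using congrFun ht i
    · have := congrFun ht j
      rw [hL, if_neg hj, Pi.zero_apply] at this
      linarith
  obtain ⟨t, ht⟩ := LinearMap.injective_iff_surjective.1 hinj (fun j => if i = j then 0 else 1)
  refine ⟨t, by simpa [hL] using congrFun ht i, fun j hj => ?_⟩
  have := congrFun ht j
  simp only [hL, if_neg hj] at this
  linarith

/-- Any solution of the hitting-time equations for a fixed target `i` is at least one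
away from `i`. -/
lemma one_le_of_eq_one_add_sum_mul {X : Type*} [Fintype X]
    {Q : Matrix X X ℝ} (hQ0 : ∀ x y, 0 < Q x y) (hQ1 : ∀ x, ∑ y, Q x y = 1)
    {i : X} {t : X → ℝ} (hi : t i = 0)
    (h : ∀ j, i ≠ j → t j = 1 + ∑ k, t k * Q k j) {j : X} (hj : i ≠ j) : 1 ≤ t j := by
  have hneg : ∀ j, max (-t j) 0 = 0 := by
    refine eq_zero_of_le_sum_mul (i := i) (u := fun j => max (-t j) 0) hQ0 hQ1
      (fun j => le_max_right _ _) (by simp [hi]) fun j hj => max_le ?_ ?_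
    · have : ∑ k, -t k * Q k j ≤ ∑ k, max (-t k) 0 * Q k j :=
        Finset.sum_le_sum fun k _ => mul_le_mul_of_nonneg_right (le_max_left _ _) (hQ0 k j).le
      simp only [neg_mul, Finset.sum_neg_distrib] at this
      linarith [h j hj]
    · exact Finset.sum_nonneg fun k _ => mul_nonneg (le_max_right _ _) (hQ0 k j).le
  have hnonneg : ∀ k, 0 ≤ t k := fun k => neg_nonpos.1 (max_eq_right_iff.1 (hneg k))
  rw [h j hj]
  exact le_add_of_nonneg_right
    (Finset.sum_nonneg fun k _ => mul_nonneg (hnonneg k) (hQ0 k j).le)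


/-- For a row-stochastic matrix `Q` with strictly positive entries,
there is a unique matrix `T` of mean first-hitting times: `T i i = 0` and
`T i j = 1 + ∑ₖ T i k * Q k j` for `i ≠ j`; moreover `T i j ≥ 1` for `i ≠ j`. -/
theorem stmt_10 {X : Type*} [Fintype X] [Nonempty X]
    (Q : Matrix X X ℝ) (hQ0 : ∀ x y, 0 < Q x y) (hQ1 : ∀ x, ∑ y, Q x y = 1) :
    (∃! T : X → X → ℝ, (∀ i, T i i = 0) ∧
      ∀ i j, i ≠ j → T i j = 1 + ∑ k, T i k * Q k j) ∧
    (∀ T : X → X → ℝ, (∀ i, T i i = 0) →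
      (∀ i j, i ≠ j → T i j = 1 + ∑ k, T i k * Q k j) →
      ∀ i j, i ≠ j → 1 ≤ T i j) := by
  choose T hT0 hT1 using exists_eq_one_add_sum_mul hQ0 hQ1
  refine ⟨⟨T, ⟨hT0, hT1⟩, fun S hS => funext fun i => sub_eq_zero.1 ?_⟩,
    fun S hS0 hS1 i j hij => one_le_of_eq_one_add_sum_mul hQ0 hQ1 (hS0 i) (hS1 i) hij⟩
  refine eq_zero_of_eq_sum_mul hQ0 hQ1 (i := i) (by simp [hS.1 i, hT0 i]) fun j hj => ?_
  simp only [Pi.sub_apply, sub_mul, Finset.sum_sub_distrib]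
  linarith [hS.2 i j hj, hT1 i j hj]
end

section
/- Let X and Y be nonempty finite types, let p : X → ℝ and q : Y → ℝ be probability vectors with p x > 0 for all x and q y > 0 for all y, and let T_X : X → X → ℝ and T_Y : Y → Y → ℝ be functions satisfying T_X x x = 0 for all x, T_Y y y = 0 for all y, the separation property that T_X x x' = 0 implies x = x', and the separation property that T_Y y y' = 0 implies y = y'. Suppose there is a coupling μ : X → Y → ℝ of p and q such that whenever μ x y > 0 and μ x' y' > 0 one has T_X x x' = T_Y y y'. Then there exists a bijection φ : X → Y such that T_X x x' = T_Y (φ x) (φ x') for all x, x' ∈ X and p x = q (φ x) for all x ∈ X. -/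
/-- A zero-cost coupling between quasi-metric measure spaces with
fully supported probability vectors induces a measure-preserving bijection matching
the quasi-distances. -/
theorem stmt_13 {X Y : Type*} [Fintype X] [Nonempty X] [Fintype Y] [Nonempty Y]
    (p : X → ℝ) (hp0 : ∀ x, 0 < p x) (hp1 : ∑ x, p x = 1)
    (q : Y → ℝ) (hq0 : ∀ y, 0 < q y) (hq1 : ∑ y, q y = 1)
    (TX : X → X → ℝ) (TY : Y → Y → ℝ)
    (hTX : ∀ x, TX x x = 0) (hTY : ∀ y, TY y y = 0)
    (hTXsep : ∀ x x', TX x x' = 0 → x = x')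
    (hTYsep : ∀ y y', TY y y' = 0 → y = y')
    (μ : X → Y → ℝ) (hμ0 : ∀ x y, 0 ≤ μ x y)
    (hμrow : ∀ x, ∑ y, μ x y = p x) (hμcol : ∀ y, ∑ x, μ x y = q y)
    (hzero : ∀ x y x' y', 0 < μ x y → 0 < μ x' y' → TX x x' = TY y y') :
    ∃ φ : X ≃ Y, (∀ x x', TX x x' = TY (φ x) (φ x')) ∧ (∀ x, p x = q (φ x)) := by
  have hrow : ∀ x, ∃ y, 0 < μ x y := fun x ↦ by
    by_contra! h
    exact (hp0 x).not_ge (hμrow x ▸ Finset.sum_nonpos fun y _ ↦ h y)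
  have hcol : ∀ y, ∃ x, 0 < μ x y := fun y ↦ by
    by_contra! h
    exact (hq0 y).not_ge (hμcol y ▸ Finset.sum_nonpos fun x _ ↦ h x)
  choose f hf using hrow
  choose g hg using hcol
  have hf_unique : ∀ x y, 0 < μ x y → y = f x := fun x y h ↦
    hTYsep _ _ ((hzero x y x (f x) h (hf x)).symm.trans (hTX x))
  have hg_unique : ∀ x y, 0 < μ x y → x = g y := fun x y h ↦
    hTXsep _ _ ((hzero x y (g y) y h (hg y)).trans (hTY y))
  refine ⟨⟨f, g, fun x ↦ (hg_unique _ _ (hf x)).symm, fun y ↦ (hf_unique _ _ (hg y)).symm⟩,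
    fun x x' ↦ hzero _ _ _ _ (hf x) (hf x'), fun x ↦ ?_⟩
  calc p x = ∑ y, μ x y := (hμrow x).symm
    _ = μ x (f x) := Fintype.sum_eq_single _ fun y hy ↦
      le_antisymm (not_lt.mp fun h ↦ hy (hf_unique x y h)) (hμ0 x y)
    _ = ∑ x', μ x' (f x) := (Fintype.sum_eq_single _ fun x' hx' ↦
      le_antisymm (not_lt.mp fun h ↦ hx'
        ((hg_unique x' _ h).trans (hg_unique x _ (hf x)).symm)) (hμ0 x' _)).symm
    _ = q (f x) := hμcol (f x)
end

section
/- Let X be a nonempty finite type and let Q : X → X → ℝ be a row-stochastic matrix with all entries strictly positive. Let T : X → X → ℝ be the unique matrix satisfying T i i = 0 for all i and T i j = 1 + ∑_k T i k · Q k j for all i ≠ j, and suppose a matrix T' : X → X → ℝ also satisfies T' i i = 0 for all i and T' i j = 1 + ∑_k T' i k · Q k j for all i ≠ j. Then T' = T. -/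
/-- A vector that vanishes at `i` and is fixed, away from `i`, by right multiplication with a
strictly positive row-stochastic matrix is zero. -/
theorem eq_zero_of_vecMul_eq_off {X : Type*} [Fintype X]
    {Q : Matrix X X ℝ} (hQ0 : ∀ x y, 0 < Q x y) (hQ1 : ∀ x, ∑ y, Q x y = 1)
    {v : X → ℝ} {i : X} (hi : v i = 0) (hv : ∀ j, j ≠ i → v j = ∑ k, v k * Q k j) :
    v = 0 := by
  classical
  have hle : ∀ j, |v j| ≤ (∑ k, |v k| * Q k j) - if j = i then ∑ k, |v k| * Q k i else 0 := by
    intro j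
    by_cases hj : j = i
    · subst hj
      simp [hi]
    · rw [if_neg hj, sub_zero, hv j hj]
      refine (Finset.abs_sum_le_sum_abs _ _).trans_eq (Finset.sum_congr rfl fun k _ => ?_)
      rw [abs_mul, abs_of_pos (hQ0 k j)]
  have htotal : ∑ j, ∑ k, |v k| * Q k j = ∑ k, |v k| := by
    rw [Finset.sum_comm]
    simp_rw [← Finset.mul_sum, hQ1, mul_one]
  have hsum := Finset.sum_le_sum fun j (_ : j ∈ Finset.univ) => hle j
  rw [Finset.sum_sub_distrib, htotal, Finset.sum_ite_eq' Finset.univ i,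
    if_pos (Finset.mem_univ i)] at hsum
  have hnonneg : ∀ k ∈ Finset.univ, 0 ≤ |v k| * Q k i :=
    fun k _ => mul_nonneg (abs_nonneg _) (hQ0 k i).le
  have hzero : ∑ k, |v k| * Q k i = 0 :=
    le_antisymm (by linarith) (Finset.sum_nonneg hnonneg)
  funext k
  have hk := (Finset.sum_eq_zero_iff_of_nonneg hnonneg).1 hzero k (Finset.mem_univ k)
  simpa [(hQ0 k i).ne'] using hk

/-- Uniqueness of the mean first-hitting time matrix: if `T` and
`T'` both satisfy the first-hitting-time recursion for a strictly positive
row-stochastic matrix `Q`, then `T' = T`. -/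
theorem stmt_16 {X : Type*} [Fintype X] [Nonempty X]
    (Q : Matrix X X ℝ) (hQ0 : ∀ x y, 0 < Q x y) (hQ1 : ∀ x, ∑ y, Q x y = 1)
    (T : X → X → ℝ) (hTdiag : ∀ i, T i i = 0)
    (hTrec : ∀ i j, i ≠ j → T i j = 1 + ∑ k, T i k * Q k j)
    (T' : X → X → ℝ) (hT'diag : ∀ i, T' i i = 0)
    (hT'rec : ∀ i j, i ≠ j → T' i j = 1 + ∑ k, T' i k * Q k j) :
    T' = T := by
  funext i
  have h : T' i - T i = 0 := by
    refine eq_zero_of_vecMul_eq_off hQ0 hQ1 (i := i) (by simp [hTdiag, hT'diag]) fun j hj => ?_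
    simp only [Pi.sub_apply, sub_mul, Finset.sum_sub_distrib]
    rw [hTrec i j hj.symm, hT'rec i j hj.symm]
    ring
  exact sub_eq_zero.1 h
end
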